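/- For every real number a: 0 ≤ a² − 2a·tanh(a) + 2·log(cosh(a)) ≤ 2a², where tanh is the real hyperbolic tangent and cosh the real hyperbolic cosine. -/

import Mathlib

theorem Real.tanh_sq_le_two_mul_log_cosh (x : ℝ) :
    Real.tanh x ^ 2 ≤ 2 * Real.log (Real.cosh x) := by
  have hc : 0 < Real.cosh x := Real.cosh_pos x
  have hlog := Real.one_sub_inv_le_log_of_pos (pow_pos hc 2)
  rw [Real.log_pow] at hlog
  push_cast at hlog
  have htanh : Real.tanh x ^ 2 = 1 - (Real.cosh x ^ 2)⁻¹ := by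
    rw [Real.tanh_eq_sinh_div_cosh, div_pow, Real.sinh_sq]
    field_simp
  linarith

theorem Real.mul_tanh_nonneg (x : ℝ) : 0 ≤ x * Real.tanh x := by
  rw [Real.tanh_eq_sinh_div_cosh, ← mul_div_assoc]
  refine div_nonneg ?_ (Real.cosh_pos x).le
  rcases le_total 0 x with h | h
  · exact mul_nonneg h (Real.sinh_nonneg_iff.2 h)
  · exact mul_nonneg_of_nonpos_of_nonpos h (Real.sinh_nonpos_iff.2 h)

theorem Real.two_mul_log_cosh_le_sq (x : ℝ) : 2 * Real.log (Real.cosh x) ≤ x ^ 2 := by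
  have h := Real.log_le_log (Real.cosh_pos x) (Real.cosh_le_exp_half_sq x)
  rw [Real.log_exp] at h
  linarith

theorem penalty_residual_bounds (a : ℝ) :
    0 ≤ a ^ 2 - 2 * a * Real.tanh a + 2 * Real.log (Real.cosh a)
      ∧ a ^ 2 - 2 * a * Real.tanh a + 2 * Real.log (Real.cosh a) ≤ 2 * a ^ 2 := by
  constructor
  · nlinarith [Real.tanh_sq_le_two_mul_log_cosh a, sq_nonneg (a - Real.tanh a)]
  · linarith [Real.mul_tanh_nonneg a, Real.two_mul_log_cosh_le_sq a]
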